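/- Equilibrium of the designed mechanism: For any N ≥ 2 and any ε > 0, the strategy profile σ^(ε) in which every individual uses the ε-strategy is a Nash equilibrium of the payment mechanism R^{(N,ε)}. -/

import Mathlib

open Real

/-- The set of possible reports: `some b` is report `b ∈ {0,1}`, `none` is nonparticipation `⊥`. -/
abbrev Report := Option Bool

/-- A (behavioral) strategy: a conditional distribution of the report given the signal. -/
def IsStrategy (σ : Bool → Report → ℝ) : Prop :=
  (∀ s x, 0 ≤ σ s x) ∧ ∀ s, ∑ x : Report, σ s x = 1

/-- `P_σ(X ∈ E | S = s)`. -/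
def probE (σ : Bool → Report → ℝ) (E : Finset Report) (s : Bool) : ℝ :=
  ∑ x ∈ E, σ s x

/-- One log-likelihood-ratio term `ln(a/b)`, with the convention `0/0 = 1`,
clamped into `[0,∞]` (this does not change the supremum defining the privacy level,
since the supremum is always ≥ 0). -/
noncomputable def llr (a b : ℝ) : ENNReal :=
  if a = 0 ∧ b = 0 then 0
  else if b = 0 then ⊤
  else ENNReal.ofReal (Real.log (a / b))

/-- The (local) differential privacy level `ζ(σ)` of a strategy, valued in `[0,∞]`. -/
noncomputable def privLevel (σ : Bool → Report → ℝ) : ENNReal :=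
  ⨆ (E : Finset Report), ⨆ (s : Bool), llr (probE σ E s) (probE σ E (!s))

/-- The privacy cost `g(ζ(σ))`, valued in extended reals (at `ζ = ∞` we take the
supremum extension of `g`). -/
noncomputable def privCost (g : ℝ → ℝ) (σ : Bool → Report → ℝ) : EReal :=
  if privLevel σ = ⊤ then ⨆ x ∈ Set.Ici (0:ℝ), ((g x : ℝ) : EReal)
  else ((g (privLevel σ).toReal : ℝ) : EReal)

/-- `P(S_i = s | W = w) = θ` if `s = w`, else `1 - θ`. -/
def signalProb (θ : ℝ) (w s : Bool) : ℝ := if s = w then θ else 1 - θ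

/-- Joint probability of state `w`, signals `s` and reports `x`, where `p = P_W(1)`. -/
def jointProb {N : ℕ} (p θ : ℝ) (σ : Fin N → Bool → Report → ℝ)
    (w : Bool) (s : Fin N → Bool) (x : Fin N → Report) : ℝ :=
  (if w then p else 1 - p) * ∏ i, (signalProb θ w (s i) * σ i (s i) (x i))

/-- Expected payment `E_σ[R_i(X)]` to individual `i`. -/
noncomputable def expPay {N : ℕ} (p θ : ℝ) (σ : Fin N → Bool → Report → ℝ)
    (R : (Fin N → Report) → Fin N → ℝ) (i : Fin N) : ℝ :=
  ∑ w : Bool, ∑ s : Fin N → Bool, ∑ x : Fin N → Report,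
    jointProb p θ σ w s x * R x i

/-- Expected utility of individual `i`: expected payment minus privacy cost. -/
noncomputable def utility {N : ℕ} (p θ : ℝ) (g : ℝ → ℝ)
    (σ : Fin N → Bool → Report → ℝ)
    (R : (Fin N → Report) → Fin N → ℝ) (i : Fin N) : EReal :=
  ((expPay p θ σ R i : ℝ) : EReal) - privCost g (σ i)

/-- `σ` is a Nash equilibrium of the payment mechanism `R`. -/
def NashEq {N : ℕ} (p θ : ℝ) (g : ℝ → ℝ)
    (σ : Fin N → Bool → Report → ℝ)
    (R : (Fin N → Report) → Fin N → ℝ) : Prop :=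
  (∀ i, IsStrategy (σ i)) ∧
  ∀ (i : Fin N) (σ' : Bool → Report → ℝ), IsStrategy σ' →
    utility p θ g (Function.update σ i σ') R i ≤ utility p θ g σ R i

/-- The `ε`-strategy: symmetric randomized response flipping with prob. `1/(e^ε+1)`. -/
noncomputable def epsStrategy (ε : ℝ) : Bool → Report → ℝ :=
  fun s x => match x with
  | none => 0
  | some b => if b = s then Real.exp ε / (Real.exp ε + 1) else 1 / (Real.exp ε + 1)

/-- The lower bound `V_LB(ε)` on the value of `ε` units of privacy. -/
noncomputable def VLB (θ : ℝ) (g' : ℝ → ℝ) (ε : ℝ) : ℝ :=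
  g' ε * ((Real.exp ε + 1) / Real.exp ε) *
    ((θ / (2 * θ - 1)) * (Real.exp ε + 1) - 1)

/-- The hypotheses on the privacy cost function `g` (with derivative `g'`):
proper (nonnegative, `g(0) = 0`, non-decreasing), convex, continuously differentiable,
and vanishing only at `0`. -/
structure ProperCost (g g' : ℝ → ℝ) : Prop where
  conv : ConvexOn ℝ (Set.Ici 0) g
  deriv : ∀ x ∈ Set.Ici (0:ℝ), HasDerivAt g (g' x) x
  derivCont : ContinuousOn g' (Set.Ici 0)
  mono : MonotoneOn g (Set.Ici 0)
  nonneg : ∀ x ∈ Set.Ici (0:ℝ), 0 ≤ g x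
  zero : g 0 = 0
  pos : ∀ x > (0:ℝ), 0 < g x


/-- The set of participants: individuals whose report is not `⊥`. -/
def participants {N : ℕ} (x : Fin N → Report) : Finset (Fin N) :=
  Finset.univ.filter (fun j => x j ≠ none)

/-- The majority `M_{−i}` of the other participants' reports:
`1` iff the number of `1`-reports among participants other than `i` is at least
`⌊(n−1)/2⌋ + 1`, where `n` is the total number of participants. -/
def majOthers {N : ℕ} (x : Fin N → Report) (i : Fin N) : Bool :=
  ((participants x).card - 1) / 2 + 1 ≤
    (((participants x).erase i).filter (fun j => x j = some true)).card

/-- `α = θ·e^ε/(e^ε+1) + (1−θ)·1/(e^ε+1)`. -/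
noncomputable def alphaP (θ ε : ℝ) : ℝ := (θ * Real.exp ε + 1 - θ) / (Real.exp ε + 1)

/-- `β^{(n)} = P(Binomial(n−1, α) ≥ ⌊(n−1)/2⌋ + 1)`. -/
noncomputable def betaP (α : ℝ) (n : ℕ) : ℝ :=
  ∑ k ∈ Finset.Icc ((n-1)/2 + 1) (n-1),
    ((n-1).choose k : ℝ) * α^k * (1-α)^(n-1-k)

/-- `γ^{(n)}`: `1 − C(n−1,(n−1)/2)·α^{(n−1)/2}(1−α)^{(n−1)/2}` if `n−1` is even, else `1`. -/
noncomputable def gammaP (α : ℝ) (n : ℕ) : ℝ :=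
  if (n-1) % 2 = 0 then
    1 - ((n-1).choose ((n-1)/2) : ℝ) * α^((n-1)/2) * (1-α)^((n-1)/2)
  else 1

/-- The payment parameter `A_{1,1}` (with `p = P_W(1)`). -/
noncomputable def A11 (p θ α : ℝ) (n : ℕ) : ℝ :=
  (p * (1 - betaP α n) + (1-p) * (1 - (gammaP α n - betaP α n))) /
    ((2 * betaP α n - gammaP α n) * (2*θ - 1) * p * (1-p))

/-- The payment parameter `A_{0,0}` (with `p = P_W(1)`). -/
noncomputable def A00 (p θ α : ℝ) (n : ℕ) : ℝ :=
  (p * betaP α n + (1-p) * (gammaP α n - betaP α n)) /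
    ((2 * betaP α n - gammaP α n) * (2*θ - 1) * p * (1-p))

/-- The designed payment mechanism `R^{(N,ε)}`: non-participants get `0`; if there is at
most one participant, everyone gets `0`; otherwise participant `i` receives
`(g'(ε)(e^ε+1)²/(2e^ε))·A_{x_i, M_{−i}}`, where `A_{0,1} = A_{1,0} = 0`. -/
noncomputable def mechR (p θ : ℝ) (g' : ℝ → ℝ) (ε : ℝ) {N : ℕ}
    (x : Fin N → Report) (i : Fin N) : ℝ :=
  if (participants x).card ≤ 1 then 0
  else
    (g' ε * (Real.exp ε + 1)^2 / (2 * Real.exp ε)) *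
      (match x i, majOthers x i with
        | some true, true => A11 p θ (alphaP θ ε) (participants x).card
        | some false, false => A00 p θ (alphaP θ ε) (participants x).card
        | _, _ => 0)

/-- The upper binomial tail `P(Binomial(m, q) ≥ ⌊m/2⌋ + 1)`. -/
noncomputable def majTail (q : ℝ) (m : ℕ) : ℝ :=
  ∑ k ∈ Finset.Icc (m / 2 + 1) m, (m.choose k : ℝ) * q ^ k * (1 - q) ^ (m - k)

lemma betaP_succ (q : ℝ) (m : ℕ) : betaP q (m + 1) = majTail q m := rfl

lemma majTail_nonneg {q : ℝ} (h0 : 0 ≤ q) (h1 : q ≤ 1) (m : ℕ) : 0 ≤ majTail q m := by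
  have : 0 ≤ 1 - q := by linarith
  unfold majTail
  positivity

lemma majTail_reflect (q : ℝ) (m : ℕ) :
    majTail (1 - q) m =
      ∑ k ∈ Finset.range (m - m / 2), (m.choose k : ℝ) * q ^ k * (1 - q) ^ (m - k) := by
  unfold majTail
  refine Finset.sum_bij' (fun k _ => m - k) (fun k _ => m - k) ?_ ?_ ?_ ?_ ?_
  · intro k hk; simp only [Finset.mem_Icc, Finset.mem_range] at *; omega
  · intro k hk; simp only [Finset.mem_Icc, Finset.mem_range] at *; omega
  · intro k hk; simp only [Finset.mem_Icc] at *; omega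
  · intro k hk; simp only [Finset.mem_range] at *; omega
  · intro k hk
    simp only [Finset.mem_Icc] at hk
    rw [Nat.choose_symm hk.2, Nat.sub_sub_self hk.2, sub_sub_cancel]
    ring

lemma binomial_sum_eq_one (q : ℝ) (m : ℕ) :
    ∑ k ∈ Finset.range (m + 1), (m.choose k : ℝ) * q ^ k * (1 - q) ^ (m - k) = 1 := by
  have h := add_pow q (1 - q) m
  rw [add_sub_cancel, one_pow] at h
  exact (Finset.sum_congr rfl fun k _ => by ring).trans h.symm

lemma majTail_add_reflect (q : ℝ) (m : ℕ) :
    majTail q m + majTail (1 - q) m = gammaP q (m + 1) := by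
  rw [majTail_reflect, majTail, gammaP, Nat.add_sub_cancel]
  have h := binomial_sum_eq_one q m
  set f : ℕ → ℝ := fun k => (m.choose k : ℝ) * q ^ k * (1 - q) ^ (m - k) with hf
  have hIcc : Finset.Icc (m / 2 + 1) m = Finset.Ico (m / 2 + 1) (m + 1) := by
    ext; simp only [Finset.mem_Icc, Finset.mem_Ico]; omega
  have hsplit := Finset.sum_range_add_sum_Ico f (show m / 2 + 1 ≤ m + 1 by omega)
  rw [hIcc]
  split_ifs with hm
  · have e : m - m / 2 = m / 2 := by omega
    rw [Finset.sum_range_succ] at hsplit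
    have hmid : f (m / 2) = (m.choose (m / 2) : ℝ) * q ^ (m / 2) * (1 - q) ^ (m / 2) := by
      simp only [hf, e]
    rw [e]
    linarith
  · have e : m - m / 2 = m / 2 + 1 := by omega
    rw [e]
    linarith

lemma gammaP_sub_betaP (q : ℝ) (m : ℕ) :
    gammaP q (m + 1) - betaP q (m + 1) = majTail (1 - q) m := by
  rw [betaP_succ, ← majTail_add_reflect]; ring

lemma majTail_reflect_lt {q : ℝ} (h0 : 1 / 2 < q) (h1 : q < 1) {m : ℕ} (hm : 1 ≤ m) :
    majTail (1 - q) m < majTail q m := by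
  unfold majTail
  refine Finset.sum_lt_sum_of_nonempty ⟨m, by simp only [Finset.mem_Icc]; omega⟩ ?_
  intro k hk
  simp only [Finset.mem_Icc] at hk
  obtain ⟨d, hd, hkd⟩ : ∃ d, d ≠ 0 ∧ k = (m - k) + d := ⟨k - (m - k), by omega, by omega⟩
  generalize m - k = l at hkd
  subst hkd
  have hq : 0 < 1 - q := by linarith
  have hq' : 0 < q := by linarith
  have hpow : (1 - q) ^ d < q ^ d := pow_lt_pow_left₀ (by linarith) hq.le hd
  have hc : (0 : ℝ) < m.choose (l + d) := by exact_mod_cast Nat.choose_pos hk.2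
  rw [sub_sub_cancel, pow_add, pow_add]
  have hpos : 0 < (m.choose (l + d) : ℝ) * ((1 - q) ^ l * q ^ l) := by positivity
  nlinarith [mul_lt_mul_of_pos_left hpow hpos]

/-- Summing over Boolean vectors with i.i.d. weights reduces to a binomial sum. -/
lemma sum_bool_prod (q : ℝ) (m : ℕ) (G : ℕ → ℝ) :
    ∑ b : Fin m → Bool, (∏ j, if b j then q else 1 - q) *
        G (Finset.univ.filter fun j => b j = true).card =
      ∑ k ∈ Finset.range (m + 1), (m.choose k : ℝ) * q ^ k * (1 - q) ^ (m - k) * G k := by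
  have h := Finset.sum_powerset_apply_card (x := (Finset.univ : Finset (Fin m)))
    fun k => q ^ k * (1 - q) ^ (m - k) * G k
  rw [Finset.card_univ, Fintype.card_fin] at h
  trans ∑ s ∈ (Finset.univ : Finset (Fin m)).powerset,
      q ^ s.card * (1 - q) ^ (m - s.card) * G s.card
  · refine Finset.sum_bij' (fun b _ => Finset.univ.filter fun j => b j = true)
      (fun s _ j => decide (j ∈ s)) ?_ ?_ ?_ ?_ ?_
    · simp
    · simp
    · intro b _; ext j; simp
    · intro s _; ext j; simp
    · intro b _
      rw [Finset.prod_ite, Finset.prod_const, Finset.prod_const]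
      congr 3
      rw [← Finset.compl_filter, Finset.card_compl, Fintype.card_fin]
  · rw [h]
    exact Finset.sum_congr rfl fun k _ => by rw [nsmul_eq_mul]; ring

lemma sum_bool_prod_majority (q : ℝ) (m : ℕ) :
    ∑ b : Fin m → Bool, (∏ j, if b j then q else 1 - q) *
        (if m / 2 + 1 ≤ (Finset.univ.filter fun j => b j = true).card then 1 else 0) =
      majTail q m := by
  rw [sum_bool_prod q m fun k => if m / 2 + 1 ≤ k then 1 else 0]
  simp only [mul_ite, mul_one, mul_zero]
  rw [← Finset.sum_filter, majTail]
  refine Finset.sum_congr ?_ fun _ _ => rfl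
  ext k; simp only [Finset.mem_filter, Finset.mem_range, Finset.mem_Icc]; omega

lemma sum_bool_prod_not_majority (q : ℝ) (m : ℕ) :
    ∑ b : Fin m → Bool, (∏ j, if b j then q else 1 - q) *
        (if m / 2 + 1 ≤ (Finset.univ.filter fun j => b j = true).card then 0 else 1) =
      1 - majTail q m := by
  have h := sum_bool_prod q m fun _ => 1
  simp only [mul_one, binomial_sum_eq_one] at h
  rw [← sum_bool_prod_majority, eq_sub_iff_add_eq, ← Finset.sum_add_distrib]
  refine (Finset.sum_congr rfl fun b _ => ?_).trans h
  split_ifs <;> ring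

/-- Marginal probability of report `x` in state `w`. -/
noncomputable def reportProb (θ : ℝ) (σ : Bool → Report → ℝ) (w : Bool) (x : Report) : ℝ :=
  ∑ b : Bool, signalProb θ w b * σ b x

lemma expPay_eq {N : ℕ} (p θ : ℝ) (σ : Fin N → Bool → Report → ℝ)
    (R : (Fin N → Report) → Fin N → ℝ) (i : Fin N) :
    expPay p θ σ R i = ∑ w : Bool, (if w then p else 1 - p) *
      ∑ x : Fin N → Report, (∏ j, reportProb θ (σ j) w (x j)) * R x i := by
  unfold expPay jointProb reportProb
  refine Finset.sum_congr rfl fun w _ => ?_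
  rw [Finset.sum_comm, Finset.mul_sum]
  refine Finset.sum_congr rfl fun x _ => ?_
  rw [← Finset.sum_mul, ← Finset.mul_sum, mul_assoc,
    ← Fintype.prod_sum fun j b => signalProb θ w b * σ j b (x j)]

lemma reportProb_epsStrategy_none (θ ε : ℝ) (w : Bool) :
    reportProb θ (epsStrategy ε) w none = 0 := by
  simp [reportProb, epsStrategy]

lemma reportProb_epsStrategy_some (θ ε : ℝ) (w b : Bool) :
    reportProb θ (epsStrategy ε) w (some b) =
      if b then (if w then alphaP θ ε else 1 - alphaP θ ε)
      else 1 - (if w then alphaP θ ε else 1 - alphaP θ ε) := by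
  have : Real.exp ε + 1 ≠ 0 := by positivity
  cases w <;> cases b <;>
    simp [reportProb, epsStrategy, signalProb, alphaP] <;> field_simp <;> ring

lemma sum_report_of_none_eq_zero {m : ℕ} (r : Report → ℝ) (hr : r none = 0)
    (F : (Fin m → Report) → ℝ) :
    ∑ z : Fin m → Report, (∏ j, r (z j)) * F z =
      ∑ b : Fin m → Bool, (∏ j, r (some (b j))) * F fun j => some (b j) := by
  symm
  refine Finset.sum_of_injOn (fun b j => some (b j)) ?_ (by simp) ?_ (fun _ _ => rfl)
  · intro b _ c _ h
    ext j
    simpa using congrFun h j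
  · intro z _ hz
    have : ∃ j, z j = none := by
      by_contra! hne
      refine hz ⟨fun j => (z j).get (Option.isSome_iff_ne_none.2 (hne j)), by simp, ?_⟩
      ext1 j
      simp
    obtain ⟨j, hj⟩ := this
    rw [Finset.prod_eq_zero (Finset.mem_univ j) (by rw [hj, hr]), zero_mul]

lemma participants_insertNth {m : ℕ} (i : Fin (m + 1)) (y : Bool) (b : Fin m → Bool) :
    participants (i.insertNth (α := fun _ => Report) (some y) fun j => some (b j)) =
      Finset.univ := by
  ext j
  refine Fin.succAboveCases i ?_ (fun k => ?_) j <;> simp [participants]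

lemma majOthers_insertNth {m : ℕ} (i : Fin (m + 1)) (y : Bool) (b : Fin m → Bool) :
    majOthers (i.insertNth (α := fun _ => Report) (some y) fun j => some (b j)) i =
      decide (m / 2 + 1 ≤ (Finset.univ.filter fun j => b j = true).card) := by
  unfold majOthers
  rw [participants_insertNth, Finset.card_univ, Fintype.card_fin, Nat.add_sub_cancel]
  congr 2
  rw [← Finset.card_map i.succAboveEmb]
  congr 1
  ext j
  refine Fin.succAboveCases i ?_ (fun k => ?_) j <;> simp

/-- The scale factor of the payments. -/
noncomputable def payScale (g' : ℝ → ℝ) (ε : ℝ) : ℝ :=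
  g' ε * (Real.exp ε + 1) ^ 2 / (2 * Real.exp ε)

lemma mechR_insertNth {m : ℕ} (hm : 1 ≤ m) (p θ ε : ℝ) (g' : ℝ → ℝ) (i : Fin (m + 1))
    (y : Bool) (b : Fin m → Bool) :
    mechR p θ g' ε (i.insertNth (α := fun _ => Report) (some y) fun j => some (b j)) i =
      payScale g' ε *
        if y then A11 p θ (alphaP θ ε) (m + 1) *
          (if m / 2 + 1 ≤ (Finset.univ.filter fun j => b j = true).card then 1 else 0)
        else A00 p θ (alphaP θ ε) (m + 1) *
          (if m / 2 + 1 ≤ (Finset.univ.filter fun j => b j = true).card then 0 else 1) := by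
  unfold mechR
  rw [participants_insertNth, majOthers_insertNth, Finset.card_univ, Fintype.card_fin,
    if_neg (by omega), Fin.insertNth_apply_same, ← payScale]
  congr 1
  by_cases h : m / 2 + 1 ≤ (Finset.univ.filter fun j => b j = true).card <;>
    cases y <;> simp [h]

lemma mechR_insertNth_none {m : ℕ} (p θ ε : ℝ) (g' : ℝ → ℝ) (i : Fin (m + 1))
    (z : Fin m → Report) :
    mechR p θ g' ε (i.insertNth (α := fun _ => Report) none z) i = 0 := by
  simp [mechR]

lemma sum_mechR {m : ℕ} (hm : 1 ≤ m) (p θ ε : ℝ) (g' : ℝ → ℝ) (i : Fin (m + 1))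
    (σ' : Bool → Report → ℝ) (w : Bool) :
    ∑ x : Fin (m + 1) → Report,
        (∏ j, reportProb θ (Function.update (fun _ => epsStrategy ε) i σ' j) w (x j)) *
          mechR p θ g' ε x i =
      payScale g' ε *
        (reportProb θ σ' w (some true) * A11 p θ (alphaP θ ε) (m + 1) *
            majTail (if w then alphaP θ ε else 1 - alphaP θ ε) m +
          reportProb θ σ' w (some false) * A00 p θ (alphaP θ ε) (m + 1) *
            (1 - majTail (if w then alphaP θ ε else 1 - alphaP θ ε) m)) := by
  rw [← (Fin.insertNthEquiv (fun _ => Report) i).sum_comp, Fintype.sum_prod_type]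
  have key : ∀ y : Report, (∑ z : Fin m → Report,
      (∏ j, reportProb θ (Function.update (fun _ => epsStrategy ε) i σ' j) w
        (i.insertNth (α := fun _ => Report) y z j)) *
          mechR p θ g' ε (i.insertNth (α := fun _ => Report) y z) i) =
      reportProb θ σ' w y * ∑ z : Fin m → Report,
        (∏ j, reportProb θ (epsStrategy ε) w (z j)) *
          mechR p θ g' ε (i.insertNth (α := fun _ => Report) y z) i := by
    intro y
    rw [Finset.mul_sum]
    refine Finset.sum_congr rfl fun z _ => ?_
    rw [Fin.prod_univ_succAbove _ i]
    simp [mul_assoc]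
  have some_case : ∀ y : Bool, (∑ z : Fin m → Report,
        (∏ j, reportProb θ (epsStrategy ε) w (z j)) *
          mechR p θ g' ε (i.insertNth (α := fun _ => Report) (some y) z) i) =
      payScale g' ε * if y then A11 p θ (alphaP θ ε) (m + 1) *
          majTail (if w then alphaP θ ε else 1 - alphaP θ ε) m
        else A00 p θ (alphaP θ ε) (m + 1) *
          (1 - majTail (if w then alphaP θ ε else 1 - alphaP θ ε) m) := by
    intro y
    rw [sum_report_of_none_eq_zero _ (reportProb_epsStrategy_none θ ε w)]
    simp only [mechR_insertNth hm, reportProb_epsStrategy_some]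
    cases y
    · rw [← sum_bool_prod_not_majority]
      simp only [Bool.false_eq_true, if_false, Finset.mul_sum]
      exact Finset.sum_congr rfl fun b _ => by ring
    · rw [← sum_bool_prod_majority]
      simp only [if_true, Finset.mul_sum]
      exact Finset.sum_congr rfl fun b _ => by ring
  refine (Finset.sum_congr rfl fun y _ => key y).trans ?_
  simp only [Fintype.sum_option, some_case, mechR_insertNth_none, Fintype.sum_bool]
  simp
  ring

lemma half_lt_alphaP {θ ε : ℝ} (hθ : 1 / 2 < θ) (hε : 0 < ε) : 1 / 2 < alphaP θ ε := by
  have := Real.one_lt_exp_iff.2 hε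
  rw [alphaP, lt_div_iff₀ (by positivity)]
  nlinarith

lemma alphaP_lt_one {θ ε : ℝ} (hθ : 0 < θ) (hθ1 : θ < 1) : alphaP θ ε < 1 := by
  have := Real.exp_pos ε
  rw [alphaP, div_lt_one (by positivity)]
  nlinarith

/-- Against the `ε`-strategy, the payment is affine in the probabilities of truthful and
participating reports, with nonnegative participation coefficients. -/
lemma exists_expPay_update_eq {m : ℕ} (hm : 1 ≤ m) {p θ ε : ℝ} (hp0 : 0 < p) (hp1 : p < 1)
    (hθ : 1 / 2 < θ) (hθ1 : θ < 1) (hε : 0 < ε) (g' : ℝ → ℝ) (i : Fin (m + 1)) :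
    ∃ u v : ℝ, 0 ≤ u ∧ 0 ≤ v ∧ ∀ σ' : Bool → Report → ℝ,
      expPay p θ (Function.update (fun _ => epsStrategy ε) i σ') (mechR p θ g' ε) i =
        payScale g' ε * (u * (σ' true (some true) + σ' true (some false)) +
          v * (σ' false (some true) + σ' false (some false)) +
          (σ' true (some true) + σ' false (some false))) := by
  have ha := half_lt_alphaP hθ hε
  have ha1 := alphaP_lt_one (ε := ε) (by linarith) hθ1
  have hlt := majTail_reflect_lt ha ha1 hm
  have hs := gammaP_sub_betaP (alphaP θ ε) m
  have hsum : ∀ q : ℝ, 0 ≤ q → q ≤ 1 → majTail q m ≤ 1 := by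
    intro q h0 h1
    rw [← sub_nonneg, ← sum_bool_prod_not_majority]
    refine Finset.sum_nonneg fun b _ => mul_nonneg (Finset.prod_nonneg fun j _ => ?_) ?_
    · split_ifs <;> linarith
    · split_ifs <;> norm_num
  have hβ0 := majTail_nonneg (q := alphaP θ ε) (by linarith) ha1.le m
  have hδ0 := majTail_nonneg (q := 1 - alphaP θ ε) (by linarith) (by linarith) m
  have hβ1 := hsum (alphaP θ ε) (by linarith) ha1.le
  have hδ1 := hsum (1 - alphaP θ ε) (by linarith) (by linarith)
  have hA11 : A11 p θ (alphaP θ ε) (m + 1) =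
      (p * (1 - majTail (alphaP θ ε) m) + (1 - p) * (1 - majTail (1 - alphaP θ ε) m)) /
        ((majTail (alphaP θ ε) m - majTail (1 - alphaP θ ε) m) * (2 * θ - 1) * p * (1 - p)) := by
    rw [A11, hs, ← hs, betaP_succ]; ring_nf
  have hA00 : A00 p θ (alphaP θ ε) (m + 1) =
      (p * majTail (alphaP θ ε) m + (1 - p) * majTail (1 - alphaP θ ε) m) /
        ((majTail (alphaP θ ε) m - majTail (1 - alphaP θ ε) m) * (2 * θ - 1) * p * (1 - p)) := by
    rw [A00, hs, ← hs, betaP_succ]; ring_nf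
  simp only [expPay_eq, sum_mechR hm, hA11, hA00, Fintype.sum_bool, if_true, Bool.false_eq_true,
    if_false]
  generalize majTail (alphaP θ ε) m = β at *
  generalize majTail (1 - alphaP θ ε) m = δ at *
  have h1 : 0 < β - δ := by linarith
  have h2 : 0 < 2 * θ - 1 := by linarith
  have h3 : 0 < 1 - p := by linarith
  have h4 : 0 ≤ 1 - β := by linarith
  have h5 : 0 ≤ 1 - δ := by linarith
  have h6 : 0 < θ := by linarith
  have h7 : 0 < 1 - θ := by linarith
  refine ⟨(p * β + (1 - p) * δ) * (p * θ * (1 - β) + (1 - p) * (1 - θ) * (1 - δ)) /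
      ((β - δ) * (2 * θ - 1) * p * (1 - p)),
    (p * (1 - β) + (1 - p) * (1 - δ)) * (p * (1 - θ) * β + (1 - p) * θ * δ) /
      ((β - δ) * (2 * θ - 1) * p * (1 - p)), by positivity, by positivity, fun σ' => ?_⟩
  have hD : ((β - δ) * (2 * θ - 1) * p * (1 - p)) * ((β - δ) * (2 * θ - 1) * p * (1 - p))⁻¹ = 1 :=
    mul_inv_cancel₀ (by positivity)
  simp only [Fintype.sum_bool, reportProb, signalProb, if_true, Bool.false_eq_true,
    Bool.true_eq_false, if_false, div_eq_mul_inv]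
  generalize ((β - δ) * (2 * θ - 1) * p * (1 - p))⁻¹ = d at *
  linear_combination payScale g' ε * (σ' true (some true) + σ' false (some false)) * hD

lemma isStrategy_epsStrategy (ε : ℝ) : IsStrategy (epsStrategy ε) := by
  refine ⟨fun s x => ?_, fun s => ?_⟩
  · rcases x with _ | b
    · simp [epsStrategy]
    · simp only [epsStrategy]
      split_ifs <;> positivity
  · have : Real.exp ε + 1 ≠ 0 := by positivity
    cases s <;> simp [epsStrategy, Fintype.sum_option] <;> field_simp
    ring

lemma llr_le_ofReal {a b ε : ℝ} (hb : 0 ≤ b) (hε : 0 ≤ ε) (ha : 0 ≤ a)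
    (hab : a ≤ Real.exp ε * b) : llr a b ≤ ENNReal.ofReal ε := by
  unfold llr
  split_ifs with h h'
  · exact zero_le
  · subst h'
    exact absurd ⟨by linarith, rfl⟩ h
  · refine ENNReal.ofReal_le_ofReal ?_
    have hb' : 0 < b := lt_of_le_of_ne hb (Ne.symm h')
    rcases ha.eq_or_lt with rfl | ha'
    · simpa using hε
    · rw [Real.log_le_iff_le_exp (by positivity), div_le_iff₀ hb']
      exact hab

lemma privLevel_epsStrategy_le {ε : ℝ} (hε : 0 < ε) :
    privLevel (epsStrategy ε) ≤ ENNReal.ofReal ε := by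
  have hnn := (isStrategy_epsStrategy ε).1
  refine iSup_le fun E => iSup_le fun s => llr_le_ofReal
    (Finset.sum_nonneg fun x _ => hnn _ x) hε.le (Finset.sum_nonneg fun x _ => hnn _ x) ?_
  rw [probE, probE, Finset.mul_sum]
  refine Finset.sum_le_sum fun x _ => ?_
  have h1 := Real.one_lt_exp_iff.2 hε
  rcases x with _ | b
  · simp [epsStrategy]
  · have h : 0 < Real.exp ε + 1 := by positivity
    cases b <;> cases s <;>
      simp only [epsStrategy, if_true, Bool.not_true, Bool.not_false, Bool.false_eq_true,
        Bool.true_eq_false, if_false] <;>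
      rw [← mul_div_assoc, div_le_div_iff_of_pos_right h] <;> nlinarith

lemma le_exp_privLevel_mul {σ : Bool → Report → ℝ} (hσ : IsStrategy σ) (h : privLevel σ ≠ ⊤)
    (s : Bool) (x : Report) : σ s x ≤ Real.exp (privLevel σ).toReal * σ (!s) x := by
  have hle : llr (σ s x) (σ (!s) x) ≤ privLevel σ := by
    have hsingle : ∀ t, probE σ {x} t = σ t x := fun t => Finset.sum_singleton _ _
    rw [← hsingle s, ← hsingle (!s)]
    exact le_iSup₂ (f := fun (E : Finset Report) (s : Bool) =>
      llr (probE σ E s) (probE σ E (!s))) {x} s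
  have hs := hσ.1 s x
  have ht := hσ.1 (!s) x
  unfold llr at hle
  split_ifs at hle with h0 h1
  · rw [h0.1, h0.2]; simp
  · exact absurd (top_le_iff.1 hle) h
  · have hb : 0 < σ (!s) x := lt_of_le_of_ne ht (Ne.symm h1)
    rcases hs.eq_or_lt with ha | ha
    · rw [← ha]; positivity
    · have := (ENNReal.ofReal_le_iff_le_toReal h).1 hle
      rwa [Real.log_le_iff_le_exp (by positivity), div_le_iff₀ hb] at this

lemma IsStrategy.sum_some_le_one {σ : Bool → Report → ℝ} (hσ : IsStrategy σ) (s : Bool) :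
    σ s (some true) + σ s (some false) ≤ 1 := by
  have h := hσ.2 s
  have h0 := hσ.1 s none
  simp only [Fintype.sum_option, Fintype.sum_bool] at h
  linarith

lemma truthful_prob_le {σ : Bool → Report → ℝ} (hσ : IsStrategy σ) (h : privLevel σ ≠ ⊤) :
    σ true (some true) + σ false (some false) ≤
      2 * (Real.exp (privLevel σ).toReal / (Real.exp (privLevel σ).toReal + 1)) := by
  have h1 := le_exp_privLevel_mul hσ h true (some true)
  have h2 := le_exp_privLevel_mul hσ h false (some false)
  have h3 := hσ.sum_some_le_one true
  have h4 := hσ.sum_some_le_one false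
  have hE := Real.exp_pos (privLevel σ).toReal
  simp only [Bool.not_true, Bool.not_false] at h1 h2
  rw [← mul_div_assoc, le_div_iff₀ (by positivity)]
  nlinarith [mul_le_mul_of_nonneg_left h3 hE.le, mul_le_mul_of_nonneg_left h4 hE.le]

/-- Tangent-line bound for the concave logistic function on `[0, ∞)`. -/
lemma logistic_le_tangent {x ε : ℝ} (hx : 0 ≤ x) (hε : 0 < ε) :
    Real.exp x / (Real.exp x + 1) - Real.exp ε / (Real.exp ε + 1) ≤
      Real.exp ε / (Real.exp ε + 1) ^ 2 * (x - ε) := by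
  have hd : ∀ y : ℝ, HasDerivAt (fun y => Real.exp y / (Real.exp y + 1))
      (Real.exp y / (Real.exp y + 1) ^ 2) y := by
    intro y
    have h := (Real.hasDerivAt_exp y).div ((Real.hasDerivAt_exp y).add_const 1)
      (by positivity : Real.exp y + 1 ≠ 0)
    refine h.congr_deriv ?_
    ring
  have hanti : AntitoneOn (deriv fun y => Real.exp y / (Real.exp y + 1)) (interior (Set.Ici 0)) := by
    intro a ha b _ hab
    rw [interior_Ici] at ha
    rw [(hd a).deriv, (hd b).deriv, div_le_div_iff₀ (by positivity) (by positivity)]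
    have ha1 := Real.one_lt_exp_iff.2 (show 0 < a from ha)
    have hab' := Real.exp_le_exp.2 hab
    nlinarith [mul_nonneg (sub_nonneg.2 hab')
      (show 0 ≤ Real.exp a * Real.exp b - 1 by nlinarith)]
  have hconc : ConcaveOn ℝ (Set.Ici 0) fun y => Real.exp y / (Real.exp y + 1) :=
    hanti.concaveOn_of_deriv (convex_Ici 0) (fun y _ => (hd y).continuousAt.continuousWithinAt)
      (fun y _ => (hd y).differentiableAt.differentiableWithinAt)
  rcases lt_trichotomy x ε with h | rfl | h
  · have := hconc.le_slope_of_hasDerivAt hx hε.le h (hd ε)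
    rw [slope_def_field, le_div_iff₀ (by linarith)] at this
    linarith
  · simp
  · have := hconc.slope_le_of_hasDerivAt hε.le hx h (hd ε)
    rw [slope_def_field, div_le_iff₀ (by linarith)] at this
    linarith

lemma ProperCost.deriv_mul_sub_le {g g' : ℝ → ℝ} (hg : ProperCost g g') {x ε : ℝ} (hx : 0 ≤ x)
    (hε : 0 ≤ ε) : g' ε * (x - ε) ≤ g x - g ε := by
  rcases lt_trichotomy x ε with h | rfl | h
  · have := hg.conv.slope_le_of_hasDerivAt hx hε h (hg.deriv ε hε)
    rw [slope_def_field, div_le_iff₀ (by linarith)] at this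
    linarith
  · simp
  · have := hg.conv.le_slope_of_hasDerivAt hε hx h (hg.deriv ε hε)
    rwa [slope_def_field, le_div_iff₀ (by linarith)] at this

lemma ProperCost.deriv_nonneg {g g' : ℝ → ℝ} (hg : ProperCost g g') {ε : ℝ} (hε : 0 < ε) :
    0 ≤ g' ε := by
  have h := hg.deriv_mul_sub_le le_rfl hε.le
  have h2 := hg.pos ε hε
  rw [hg.zero] at h
  by_contra! hneg
  nlinarith

lemma ProperCost.iSup_eq_top {g g' : ℝ → ℝ} (hg : ProperCost g g') :
    ⨆ x ∈ Set.Ici (0 : ℝ), ((g x : ℝ) : EReal) = ⊤ := by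
  rw [EReal.eq_top_iff_forall_lt]
  intro y
  have h1 := hg.deriv_mul_sub_le (x := 0) le_rfl (zero_le_one' ℝ)
  have h2 := hg.pos 1 one_pos
  rw [hg.zero] at h1
  have h3 : 0 < g' 1 := by linarith
  have hx : 0 ≤ |y| / g' 1 + 2 := by positivity
  have h4 := hg.deriv_mul_sub_le hx zero_le_one
  refine lt_of_lt_of_le ?_ (le_iSup₂ (f := fun x (_ : x ∈ Set.Ici (0 : ℝ)) =>
    ((g x : ℝ) : EReal)) (|y| / g' 1 + 2) hx)
  rw [EReal.coe_lt_coe_iff]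
  have h5 : g' 1 * (|y| / g' 1 + 2 - 1) = |y| + g' 1 := by field_simp; ring
  linarith [le_abs_self y]

lemma privCost_epsStrategy_le {g g' : ℝ → ℝ} (hg : ProperCost g g') {ε : ℝ} (hε : 0 < ε) :
    privCost g (epsStrategy ε) ≤ (g ε : ℝ) := by
  have h := privLevel_epsStrategy_le hε
  rw [privCost, if_neg (ne_top_of_le_ne_top ENNReal.ofReal_ne_top h), EReal.coe_le_coe_iff]
  exact hg.mono ENNReal.toReal_nonneg hε.le (ENNReal.toReal_le_of_le_ofReal hε.le h)

/-- **Equilibrium of the designed mechanism:** for any `N ≥ 2` and `ε > 0`, the profile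
in which every individual uses the `ε`-strategy is a Nash equilibrium of `R^{(N,ε)}`. -/
theorem designed_mechanism_equilibrium
    (N : ℕ) (hN : 2 ≤ N) (p θ : ℝ) (hp0 : 0 < p) (hp1 : p < 1)
    (hθ : 1/2 < θ) (hθ1 : θ < 1)
    (g g' : ℝ → ℝ) (hg : ProperCost g g')
    (ε : ℝ) (hε : 0 < ε) :
    NashEq p θ g (fun _ : Fin N => epsStrategy ε) (mechR p θ g' ε) := by
  obtain ⟨m, rfl⟩ : ∃ m, N = m + 1 := ⟨N - 1, by omega⟩
  refine ⟨fun _ => isStrategy_epsStrategy ε, fun i σ' hσ' => ?_⟩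
  obtain ⟨u, v, hu, hv, hpay⟩ :=
    exists_expPay_update_eq (by omega : 1 ≤ m) hp0 hp1 hθ hθ1 hε g' i
  have hself := hpay (epsStrategy ε)
  rw [Function.update_eq_self i fun _ : Fin (m + 1) => epsStrategy ε] at hself
  unfold utility
  rw [Function.update_self]
  by_cases htop : privLevel σ' = ⊤
  · rw [privCost, if_pos htop, hg.iSup_eq_top, EReal.sub_top]
    exact bot_le
  refine le_trans ?_ (EReal.sub_le_sub le_rfl (privCost_epsStrategy_le hg hε))
  rw [privCost, if_neg htop, ← EReal.coe_sub, ← EReal.coe_sub, EReal.coe_le_coe_iff, hpay, hself]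
  have hξ : 0 ≤ (privLevel σ').toReal := ENNReal.toReal_nonneg
  have htruth := truthful_prob_le hσ' htop
  have htan := logistic_le_tangent hξ hε
  have hconv := hg.deriv_mul_sub_le hξ hε.le
  have hK : 0 ≤ payScale g' ε := by
    have := hg.deriv_nonneg hε
    unfold payScale
    positivity
  have hKtan : payScale g' ε * (2 * (Real.exp ε / (Real.exp ε + 1) ^ 2)) = g' ε := by
    unfold payScale
    field_simp
  have hone : Real.exp ε / (Real.exp ε + 1) + 1 / (Real.exp ε + 1) = 1 := by
    field_simp
  have h1 := mul_le_mul_of_nonneg_left (hσ'.sum_some_le_one true) hu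
  have h2 := mul_le_mul_of_nonneg_left (hσ'.sum_some_le_one false) hv
  have hgain : u * (σ' true (some true) + σ' true (some false)) +
      v * (σ' false (some true) + σ' false (some false)) +
      (σ' true (some true) + σ' false (some false)) ≤
      u + v + 2 * (Real.exp ε / (Real.exp ε + 1)) +
        2 * (Real.exp ε / (Real.exp ε + 1) ^ 2) * ((privLevel σ').toReal - ε) := by
    linarith
  have hscaled := mul_le_mul_of_nonneg_left hgain hK
  have heps : u * (epsStrategy ε true (some true) + epsStrategy ε true (some false)) +
      v * (epsStrategy ε false (some true) + epsStrategy ε false (some false)) +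
      (epsStrategy ε true (some true) + epsStrategy ε false (some false)) =
      u + v + 2 * (Real.exp ε / (Real.exp ε + 1)) := by
    simp only [epsStrategy, if_true, Bool.false_eq_true, Bool.true_eq_false, if_false]
    rw [add_comm (1 / (Real.exp ε + 1)), hone]
    ring
  rw [heps]
  have hexpand : payScale g' ε * (u + v + 2 * (Real.exp ε / (Real.exp ε + 1)) +
      2 * (Real.exp ε / (Real.exp ε + 1) ^ 2) * ((privLevel σ').toReal - ε)) =
      payScale g' ε * (u + v + 2 * (Real.exp ε / (Real.exp ε + 1))) +
        g' ε * ((privLevel σ').toReal - ε) := by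
    rw [← hKtan]; ring
  linarith
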